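/- For every a, b > 0 and every x > 0, the convolution of the beta prime(a,b) density with itself satisfies ∫₀^x f_{a,b}(y) f_{a,b}(x−y) dy = [Γ(a+b)² x^{2a−1} / (Γ(2a) Γ(b)² (x+1)^{a+b})] · [Γ(a+1/2)/(Γ(a)Γ(1/2))] · ∫₀^1 t^{a−1} (1−t)^{−1/2} (1 + x² t / (4(x+1)))^{−(a+b)} dt. (This is the density formula of Proposition 2, with the Gauss hypergeometric factor ₂F₁(a+b, a; a+1/2; −x²/(4(x+1))) written via Euler's integral representation.) -/

import Mathlib

open MeasureTheory Set

/-- The beta prime density with parameters `a, b`. -/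
noncomputable def betaPrimeDensity (a b x : ℝ) : ℝ :=
  Real.Gamma (a + b) / (Real.Gamma a * Real.Gamma b) * x ^ (a - 1) * (1 + x) ^ (-(a + b))

/-- The integral over `[0, x]` of a function symmetric about `x / 2`, folded onto `[0, x / 2]`. -/
lemma integral_eq_two_mul_integral_half {f : ℝ → ℝ} {x : ℝ}
    (hsymm : ∀ y, f (x - y) = f y) (hf : IntervalIntegrable f volume 0 (x / 2)) :
    ∫ y in (0 : ℝ)..x, f y = 2 * ∫ y in (0 : ℝ)..(x / 2), f y := by
  have hf' : IntervalIntegrable f volume (x / 2) x := by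
    have h := (hf.comp_sub_left x).symm
    simp only [hsymm] at h
    convert h using 1 <;> ring
  have h := intervalIntegral.integral_comp_sub_left (a := 0) (b := x / 2) f x
  simp only [hsymm, sub_zero, sub_half] at h
  rw [← intervalIntegral.integral_add_adjacent_intervals hf hf', ← h, two_mul]

/-- The substitution `t = 4 * y * (x - y) / x ^ 2` on `[0, x / 2]`. -/
lemma integral_half_comp_parabola (g : ℝ → ℝ) {x : ℝ} (hx : 0 < x) :
    ∫ y in (0 : ℝ)..(x / 2), g (4 * (y * (x - y)) / x ^ 2)
      = x / 4 * ∫ t in (0 : ℝ)..1, g t * (1 - t) ^ (-(1 / 2) : ℝ) := by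
  have hsub := intervalIntegral.integral_comp_mul_deriv_of_deriv_nonneg
    (a := 0) (b := x / 2) (f := fun y => 4 * (y * (x - y)) / x ^ 2)
    (f' := fun y => 4 * (x - 2 * y) / x ^ 2) (g := fun t => g t * (1 - t) ^ (-(1 / 2) : ℝ))
    (by fun_prop)
    (fun y _ => by
      have h := (((hasDerivAt_id y).mul ((hasDerivAt_id y).const_sub x)).const_mul 4).div_const
        (x ^ 2)
      refine h.congr_deriv ?_
      simp only [id]
      ring)
    (fun y hy => by
      rw [min_eq_left (by positivity), max_eq_right (by positivity)] at hy
      have : 0 ≤ x - 2 * y := by linarith [hy.2]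
      positivity)
  have h1 : 4 * (x / 2 * (x - x / 2)) / x ^ 2 = 1 := by field_simp; ring
  simp only [h1, zero_mul, mul_zero, zero_div] at hsub
  rw [← hsub, ← intervalIntegral.integral_const_mul]
  refine intervalIntegral.integral_congr_Ioo_of_le (by positivity) fun y hy => ?_
  have hpos : 0 < (x - 2 * y) / x := div_pos (by linarith [hy.2]) hx
  have hroot : 1 - 4 * (y * (x - y)) / x ^ 2 = ((x - 2 * y) / x) ^ (2 : ℝ) := by
    rw [Real.rpow_two]
    field_simp
    ring
  have hne : x - y * 2 ≠ 0 := by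
    have := hy.2
    intro h
    linarith
  simp only [Function.comp]
  rw [hroot, ← Real.rpow_mul hpos.le]
  norm_num
  rw [Real.rpow_neg_one]
  field_simp

lemma intervalIntegrable_betaPrimeDensity_mul (a b : ℝ) {x : ℝ} (ha : 0 < a) (hx : 0 < x) :
    IntervalIntegrable (fun y => betaPrimeDensity a b y * betaPrimeDensity a b (x - y))
      volume 0 (x / 2) := by
  have hcont : ContinuousOn (fun y : ℝ => (Real.Gamma (a + b) / (Real.Gamma a * Real.Gamma b)) ^ 2
      * (1 + y) ^ (-(a + b)) * (x - y) ^ (a - 1) * (1 + (x - y)) ^ (-(a + b)))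
      (uIcc 0 (x / 2)) := by
    rw [uIcc_of_le (by positivity)]
    refine ((continuousOn_const.mul (ContinuousOn.rpow_const (by fun_prop) fun y hy => ?_)).mul
      (ContinuousOn.rpow_const (by fun_prop) fun y hy => ?_)).mul
      (ContinuousOn.rpow_const (by fun_prop) fun y hy => ?_)
    all_goals
      have := hy.1
      have := hy.2
      left
      apply ne_of_gt
      linarith
  refine ((intervalIntegral.intervalIntegrable_rpow' (r := a - 1)
    (by linarith)).mul_continuousOn hcont).congr_ae (ae_of_all _ fun y => ?_)
  simp only [betaPrimeDensity]
  ring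

/-- The normalising constant, by Legendre's duplication formula. -/
lemma two_mul_four_rpow_neg_div_Gamma_sq {a : ℝ} (ha : 0 < a) :
    2 * (4 : ℝ) ^ (-a) / Real.Gamma a ^ 2
      = Real.Gamma (a + 1 / 2) / (Real.Gamma (2 * a) * Real.Gamma a * Real.Gamma (1 / 2)) := by
  have hdup := Real.Gamma_mul_Gamma_add_half a
  have h4 : (2 : ℝ) ^ (1 - 2 * a) = 2 * (4 : ℝ) ^ (-a) := by
    rw [sub_eq_add_neg, Real.rpow_add two_pos, Real.rpow_one, ← mul_neg, Real.rpow_mul two_pos.le]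
    norm_num
  rw [h4, ← Real.Gamma_one_half_eq] at hdup
  have := Real.Gamma_pos_of_pos ha
  have := Real.Gamma_pos_of_pos (show 0 < 2 * a by positivity)
  have := Real.Gamma_pos_of_pos (show (0 : ℝ) < 1 / 2 by positivity)
  rw [div_eq_div_iff (by positivity) (by positivity)]
  linear_combination -Real.Gamma a * hdup

/-- The product of the two densities as a function of `t = 4 * y * (x - y) / x ^ 2`. -/
lemma betaPrimeDensity_mul_eq (a b : ℝ) {x y : ℝ} (hy : 0 < y) (hyx : y < x) :
    betaPrimeDensity a b y * betaPrimeDensity a b (x - y)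
      = (Real.Gamma (a + b) / (Real.Gamma a * Real.Gamma b)) ^ 2
        * ((x ^ 2 / 4) ^ (a - 1) * (x + 1) ^ (-(a + b)))
        * ((4 * (y * (x - y)) / x ^ 2) ^ (a - 1)
          * (1 + x ^ 2 * (4 * (y * (x - y)) / x ^ 2) / (4 * (x + 1))) ^ (-(a + b))) := by
  have hx : 0 < x := hy.trans hyx
  have hxy : 0 < x - y := sub_pos.mpr hyx
  have h1 : y ^ (a - 1) * (x - y) ^ (a - 1)
      = (x ^ 2 / 4) ^ (a - 1) * (4 * (y * (x - y)) / x ^ 2) ^ (a - 1) := by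
    rw [← Real.mul_rpow hy.le hxy.le, ← Real.mul_rpow (by positivity) (by positivity)]
    congr 1
    field_simp
  have h2 : (1 + y) ^ (-(a + b)) * (1 + (x - y)) ^ (-(a + b))
      = (x + 1) ^ (-(a + b))
        * (1 + x ^ 2 * (4 * (y * (x - y)) / x ^ 2) / (4 * (x + 1))) ^ (-(a + b)) := by
    rw [← Real.mul_rpow (by positivity) (by positivity),
      ← Real.mul_rpow (by positivity) (by positivity)]
    congr 1
    field_simp
    ring
  simp only [betaPrimeDensity]
  linear_combination (Real.Gamma (a + b) / (Real.Gamma a * Real.Gamma b)) ^ 2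
    * ((1 + y) ^ (-(a + b)) * (1 + (x - y)) ^ (-(a + b)) * h1
      + (x ^ 2 / 4) ^ (a - 1) * (4 * (y * (x - y)) / x ^ 2) ^ (a - 1) * h2)

/-- Density of the sum of two independent beta prime(a,b) random variables
(Proposition 2, with the hypergeometric factor written via Euler's integral). -/
theorem betaPrime_conv_density (a b x : ℝ) (ha : 0 < a) (hb : 0 < b) (hx : 0 < x) :
    (∫ y in (0 : ℝ)..x, betaPrimeDensity a b y * betaPrimeDensity a b (x - y))
      = Real.Gamma (a + b) ^ 2 * x ^ (2 * a - 1)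
          / (Real.Gamma (2 * a) * Real.Gamma b ^ 2 * (x + 1) ^ (a + b))
        * (Real.Gamma (a + 1 / 2) / (Real.Gamma a * Real.Gamma (1 / 2)))
        * ∫ t in (0 : ℝ)..1, t ^ (a - 1) * (1 - t) ^ (-(1 / 2) : ℝ)
            * (1 + x ^ 2 * t / (4 * (x + 1))) ^ (-(a + b)) := by
  rw [integral_eq_two_mul_integral_half (fun y => by rw [sub_sub_cancel, mul_comm])
      (intervalIntegrable_betaPrimeDensity_mul a b ha hx),
    intervalIntegral.integral_congr_Ioo_of_le (by positivity) fun y hy =>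
      betaPrimeDensity_mul_eq a b hy.1 (hy.2.trans (half_lt_self hx)),
    intervalIntegral.integral_const_mul,
    integral_half_comp_parabola
      (fun t => t ^ (a - 1) * (1 + x ^ 2 * t / (4 * (x + 1))) ^ (-(a + b))) hx]
  simp only [mul_right_comm ((_ : ℝ) ^ (a - 1)) _ ((1 - (_ : ℝ)) ^ (-(1 / 2) : ℝ))]
  have hpow : (x ^ 2 / 4) ^ (a - 1) * (x / 4) = x ^ (2 * a - 1) * 4 ^ (-a) := by
    rw [Real.div_rpow (by positivity) (by positivity), ← Real.rpow_natCast, ← Real.rpow_mul hx.le,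
      show 2 * a - 1 = ((2 : ℕ) : ℝ) * (a - 1) + 1 by push_cast; ring, Real.rpow_add_one hx.ne',
      Real.rpow_sub_one four_ne_zero, Real.rpow_neg zero_le_four]
    field_simp
  have hconst := two_mul_four_rpow_neg_div_Gamma_sq ha
  rw [Real.rpow_neg (by positivity : (0 : ℝ) ≤ x + 1)]
  generalize (∫ t in (0 : ℝ)..1, (_ : ℝ)) = I
  calc _ = Real.Gamma (a + b) ^ 2 / Real.Gamma b ^ 2 * ((x + 1) ^ (a + b))⁻¹ * I
        * (2 * ((x ^ 2 / 4) ^ (a - 1) * (x / 4)) / Real.Gamma a ^ 2) := by ring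
    _ = Real.Gamma (a + b) ^ 2 / Real.Gamma b ^ 2 * ((x + 1) ^ (a + b))⁻¹ * I * x ^ (2 * a - 1)
        * (2 * 4 ^ (-a) / Real.Gamma a ^ 2) := by rw [hpow]; ring
    _ = _ := by rw [hconst]; ring
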